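/- Let p be an odd prime and let G be a non-Abelian finite p-group. Then any two distinct kernels of non-linear irreducible complex characters of G are nonincident (i.e., neither contains the other) if and only if G' ⊆ Z(G) and the exponent of G' is p. -/

import Mathlib

open CategoryTheory

/-- The kernel of the character of a complex representation `V` of `G`:
`ker χ = {g ∈ G : χ(g) = χ(1)}`. -/
noncomputable def charKer {G : Type} [Group G] (V : FDRep ℂ G) : Set G :=
  {g | V.character g = V.character 1}

/-- The center of the character of a complex representation `V` of `G`:
`Z(χ) = {g ∈ G : |χ(g)| = χ(1)}`. -/
noncomputable def charCenter {G : Type} [Group G] (V : FDRep ℂ G) : Set G :=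
  {g | (‖V.character g‖ : ℂ) = V.character 1}

section Trace

open Polynomial

/-- A complex number of norm at most one has real part one only if it is one. -/
theorem Complex.eq_one_of_norm_le_one_of_re_eq_one {z : ℂ} (hz : ‖z‖ ≤ 1) (hre : z.re = 1) :
    z = 1 := by
  have h := Complex.sq_norm z
  rw [Complex.normSq_apply] at h
  have him : z.im = 0 := by
    have : z.im * z.im ≤ 0 := by nlinarith [norm_nonneg z]
    nlinarith [mul_self_nonneg z.im, mul_self_eq_zero.mp (le_antisymm this (mul_self_nonneg _))]
  apply Complex.ext <;> simp [hre, him]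

/-- Complex numbers in the closed unit disc whose sum is their number are all equal to one. -/
theorem Multiset.eq_one_of_sum_eq_card {s : Multiset ℂ} (hs : ∀ z ∈ s, ‖z‖ ≤ 1)
    (hsum : s.sum = s.card) : ∀ z ∈ s, z = 1 := by
  have hre : ∀ t : Multiset ℂ, (∀ z ∈ t, ‖z‖ ≤ 1) → t.sum.re ≤ t.card := by
    intro t
    induction t using Multiset.induction with
    | empty => simp
    | cons a t ih =>
      intro ht
      have h1 := ih fun z hz => ht z (Multiset.mem_cons_of_mem hz)
      have h2 := (Complex.re_le_norm a).trans (ht a (Multiset.mem_cons_self a t))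
      simp only [Multiset.sum_cons, Complex.add_re, Multiset.card_cons, Nat.cast_add, Nat.cast_one]
      linarith
  intro z hz
  obtain ⟨t, rfl⟩ := Multiset.exists_cons_of_mem hz
  have h1 := hre t fun w hw => hs w (Multiset.mem_cons_of_mem hw)
  have h2 := (Complex.re_le_norm z).trans (hs z hz)
  have h3 := congrArg Complex.re hsum
  simp only [Multiset.sum_cons, Complex.add_re, Multiset.card_cons, Nat.cast_add, Nat.cast_one,
    Complex.natCast_re, Complex.one_re] at h3
  exact Complex.eq_one_of_norm_le_one_of_re_eq_one (hs z hz) (by linarith)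

/-- A complex endomorphism of finite order whose trace is the dimension is the identity. -/
theorem Module.End.eq_one_of_pow_eq_one_of_trace_eq_finrank {V : Type*} [AddCommGroup V]
    [Module ℂ V] [FiniteDimensional ℂ V] {f : Module.End ℂ V} {m : ℕ} (hm : m ≠ 0)
    (hf : f ^ m = 1) (htr : LinearMap.trace ℂ V f = Module.finrank ℂ V) : f = 1 := by
  have hsplit : f.charpoly.Splits := IsAlgClosed.splits _
  have hcard : f.charpoly.roots.card = Module.finrank ℂ V := by
    rw [← hsplit.natDegree_eq_card_roots, LinearMap.charpoly_natDegree]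
  have hroots : ∀ z ∈ f.charpoly.roots, z = 1 := by
    apply Multiset.eq_one_of_sum_eq_card
    · intro z hz
      obtain ⟨v, hv⟩ := ((Module.End.hasEigenvalue_iff_isRoot_charpoly f z).mpr
        (isRoot_of_mem_roots hz)).exists_hasEigenvector
      have h := hv.pow_apply m
      rw [hf, Module.End.one_apply] at h
      have hz1 : z ^ m = 1 := by
        have h0 : (z ^ m - 1) • v = 0 := by rw [sub_smul, one_smul, ← h, sub_self]
        exact sub_eq_zero.mp ((smul_eq_zero.mp h0).resolve_right hv.2)
      exact (Complex.norm_eq_one_of_pow_eq_one hz1 hm).le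
    · rw [← Module.End.trace_eq_sum_roots_charpoly_of_splits hsplit, htr, hcard]
  have hchar : f.charpoly = (X - C 1) ^ Module.finrank ℂ V := by
    conv_lhs => rw [hsplit.eq_prod_roots_of_monic f.charpoly_monic,
      Multiset.eq_replicate_card.mpr hroots]
    rw [Multiset.map_replicate, Multiset.prod_replicate, hcard]
  have hnil : IsNilpotent (f - algebraMap ℂ (Module.End ℂ V) 1) := by
    refine ⟨Module.finrank ℂ V, ?_⟩
    have h := f.aeval_self_charpoly
    rw [hchar] at h
    simpa using h
  have hss : f.IsSemisimple := by
    refine Module.End.isSemisimple_of_squarefree_aeval_eq_zero (p := X ^ m - C (1 : ℂ)) ?_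
      (by simp [hf])
    exact (separable_X_pow_sub_C 1 (by exact_mod_cast hm) one_ne_zero).squarefree
  have h := Module.End.eq_zero_of_isNilpotent_isSemisimple hnil
    (Module.End.isSemisimple_sub_algebraMap_iff.mpr hss)
  simpa [sub_eq_zero] using h

end Trace

open scoped commutatorElement

namespace FDRep

variable {G : Type} [Group G]

/-- The kernel of the character of a representation is the kernel of the representation. -/
theorem mem_charKer_iff [Finite G] (V : FDRep ℂ G) (g : G) : g ∈ charKer V ↔ V.ρ g = 1 := by
  constructor
  · intro h
    refine Module.End.eq_one_of_pow_eq_one_of_trace_eq_finrank (m := orderOf g)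
      (orderOf_pos g).ne' ?_ ?_
    · rw [← map_pow, pow_orderOf_eq_one, map_one]
    · rw [← FDRep.char_one]
      exact h
  · intro h
    change LinearMap.trace ℂ V (V.ρ g) = LinearMap.trace ℂ V (V.ρ 1)
    rw [h, map_one V.ρ]

/-- A linear endomorphism commuting with the action, as a morphism of representations. -/
noncomputable def homOfCommute (V : FDRep ℂ G) (T : Module.End ℂ V)
    (hT : ∀ g, Commute T (V.ρ g)) : V ⟶ V :=
  ⟨InducedCategory.homMk (ModuleCat.ofHom T), fun g ↦ by
    ext1
    exact hT g⟩

/-- **Schur's lemma**: an endomorphism commuting with an irreducible action is a scalar. -/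
theorem exists_eq_smul_one_of_commute (V : FDRep ℂ G) [Simple V] (T : Module.End ℂ V)
    (hT : ∀ g, Commute T (V.ρ g)) : ∃ c : ℂ, T = c • (1 : Module.End ℂ V) := by
  have h1 : Module.finrank ℂ (V ⟶ V) = 1 := finrank_endomorphism_simple_eq_one ℂ V
  obtain ⟨c, hc⟩ := (finrank_eq_one_iff_of_nonzero' (𝟙 V) (id_nonzero V)).mp h1
    (homOfCommute V T hT)
  refine ⟨c, ?_⟩
  have h := congrArg (fun f : V ⟶ V => f.hom.hom.hom) hc
  exact h.symm

/-- An irreducible representation with commuting operators has dimension at most one. -/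
theorem finrank_le_one_of_commute (V : FDRep ℂ G) [Simple V]
    (h : ∀ g k, Commute (V.ρ g) (V.ρ k)) : Module.finrank ℂ V ≤ 1 := by
  have hscalar : ∀ T : Module.End ℂ V, ∃ c : ℂ, c • (1 : Module.End ℂ V) = T := by
    intro T
    obtain ⟨c, hc⟩ := V.exists_eq_smul_one_of_commute T fun g => by
      obtain ⟨a, ha⟩ := V.exists_eq_smul_one_of_commute (V.ρ g) (h g)
      rw [ha]
      exact (Commute.one_right T).smul_right a
    exact ⟨c, hc.symm⟩
  have h1 : Module.finrank ℂ (Module.End ℂ V) ≤ 1 := finrank_le_one _ hscalar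
  rw [Module.finrank_linearMap] at h1
  by_contra! h2
  nlinarith

/-- The derived subgroup acts trivially exactly when the operators commute. -/
theorem commutator_le_ker_iff (V : FDRep ℂ G) :
    commutator G ≤ V.ρ.ker ↔ ∀ g k, Commute (V.ρ g) (V.ρ k) := by
  rw [commutator_def, Subgroup.commutator_le]
  constructor
  · intro h g k
    have h1 : V.ρ (⁅g, k⁆ * (k * g)) = V.ρ (k * g) := by
      rw [map_mul, h g trivial k trivial, one_mul]
    have h2 : ⁅g, k⁆ * (k * g) = g * k := by group
    rw [h2, map_mul, map_mul] at h1
    exact h1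
  · intro h g _ k _
    have h2 : ⁅g, k⁆ = g * k * (k * g)⁻¹ := by group
    rw [MonoidHom.mem_ker, h2, map_mul, map_mul, (h g k).eq, ← map_mul, ← map_mul,
      mul_inv_cancel, map_one]

/-- The derived subgroup acts trivially on a representation of dimension at most one. -/
theorem commutator_le_ker_of_finrank_le_one (V : FDRep ℂ G) (h : Module.finrank ℂ V ≤ 1) :
    commutator G ≤ V.ρ.ker := by
  rw [commutator_le_ker_iff]
  obtain ⟨v, hv⟩ := finrank_le_one_iff.mp h
  intro g k
  obtain ⟨a, ha⟩ := hv (V.ρ g v)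
  obtain ⟨b, hb⟩ := hv (V.ρ k v)
  refine LinearMap.ext fun w => ?_
  obtain ⟨c, rfl⟩ := hv w
  change V.ρ g (V.ρ k (c • v)) = V.ρ k (V.ρ g (c • v))
  simp only [map_smul, ← ha, ← hb, smul_smul]
  congr 1
  ring

/-- The derived subgroup acts nontrivially on a non-linear irreducible representation. -/
theorem not_commutator_le_ker (V : FDRep ℂ G) [Simple V] (h : 1 < Module.finrank ℂ V) :
    ¬ commutator G ≤ V.ρ.ker := fun hle =>
  absurd (V.finrank_le_one_of_commute (V.commutator_le_ker_iff.mp hle)) h.not_ge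

/-- The bundling of an irreducible representation is a simple object. -/
theorem simple_of_isIrreducible [Finite G] {V : Type} [AddCommGroup V] [Module ℂ V]
    [Module.Finite ℂ V] (ρ : Representation ℂ G V) [ρ.IsIrreducible] :
    Simple (FDRep.of ρ) := by
  rw [simple_iff_end_is_rank_one]
  have hV : Nontrivial (FDRep.of ρ ⟶ FDRep.of ρ) := by
    refine ⟨𝟙 _, 0, fun h => ?_⟩
    have h0 : (1 : Module.End ℂ V) = 0 :=
      congrArg (fun f : FDRep.of ρ ⟶ FDRep.of ρ => f.hom.hom.hom) h
    have h1 := Representation.IsIrreducible.finrank_intertwiningMap_self ρ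
    have : Subsingleton V := ⟨fun x y => by
      rw [← Module.End.one_apply (R := ℂ) x, ← Module.End.one_apply (R := ℂ) y, h0]; rfl⟩
    have : Subsingleton (Representation.IntertwiningMap ρ ρ) :=
      ⟨fun f g => by ext x; exact Subsingleton.elim _ _⟩
    simp [Module.finrank_zero_of_subsingleton] at h1
  refine (finrank_eq_one_iff_of_nonzero' (𝟙 (FDRep.of ρ)) ?_).mpr fun f => ?_
  · intro h
    obtain ⟨f, hf⟩ := exists_ne (0 : FDRep.of ρ ⟶ FDRep.of ρ)
    apply hf
    rw [← Category.id_comp f, h, Limits.zero_comp]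
  · let φ : Representation.IntertwiningMap ρ ρ :=
      ⟨f.hom.hom.hom, fun g => congrArg (fun t => t.hom.hom) (f.comm g)⟩
    obtain ⟨c, hc⟩ :=
      (Representation.IsIrreducible.algebraMap_intertwiningMap_bijective_of_isAlgClosed
        (ρ := ρ)).2 φ
    refine ⟨c, ?_⟩
    ext x
    exact congrArg (fun t : Representation.IntertwiningMap ρ ρ => t.toLinearMap x) hc

/-- An element acting nontrivially on a finite-dimensional representation acts nontrivially on
some irreducible constituent. -/
theorem exists_simple_of_ne_one [Finite G] {V : Type} [AddCommGroup V] [Module ℂ V]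
    [Module.Finite ℂ V] (ρ : Representation ℂ G V) {g : G} (hg : ρ g ≠ 1) :
    ∃ S : FDRep ℂ G, Simple S ∧ S.ρ g ≠ 1 ∧ ∀ k, ρ k = 1 → S.ρ k = 1 := by
  induction hn : Module.finrank ℂ V using Nat.strong_induction_on generalizing V with
  | _ n ih =>
    subst hn
    by_cases hirr : ρ.IsIrreducible
    · exact ⟨FDRep.of ρ, simple_of_isIrreducible ρ, hg, fun k hk => hk⟩
    have hsub : ∀ τ : Subrepresentation ρ, τ ≠ ⊤ → τ.toRepresentation g ≠ 1 →
        ∃ S : FDRep ℂ G, Simple S ∧ S.ρ g ≠ 1 ∧ ∀ k, ρ k = 1 → S.ρ k = 1 := by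
      intro τ hτ hτg
      have hlt : Module.finrank ℂ τ.toSubmodule < Module.finrank ℂ V := by
        apply Submodule.finrank_lt
        intro h
        exact hτ (Subrepresentation.toSubmodule_injective h)
      obtain ⟨S, hS, hSg, hSk⟩ := ih _ hlt τ.toRepresentation hτg rfl
      refine ⟨S, hS, hSg, fun k hk => hSk k ?_⟩
      ext x
      exact congrArg (fun t : Module.End ℂ V => t x) hk
    have hnt : Nontrivial (Subrepresentation ρ) := by
      refine ⟨⊥, ⊤, fun h => hg ?_⟩
      refine LinearMap.ext fun x => ?_
      have hx : ∀ y : V, y = 0 := fun y => by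
        have : y ∈ (⊤ : Subrepresentation ρ) := trivial
        rw [← h] at this
        exact this
      rw [hx ((ρ g) x), hx ((1 : Module.End ℂ V) x)]
    obtain ⟨τ, hbot, htop⟩ : ∃ τ : Subrepresentation ρ, τ ≠ ⊥ ∧ τ ≠ ⊤ := by
      by_contra! hcon
      exact hirr ⟨fun τ => or_iff_not_imp_left.mpr (hcon τ)⟩
    obtain ⟨σ, hσ⟩ := exists_isCompl τ
    by_cases h1 : τ.toRepresentation g = 1
    · by_cases h2 : σ.toRepresentation g = 1
      · refine absurd (LinearMap.ext fun x => ?_) hg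
        have hx : x ∈ (τ ⊔ σ : Subrepresentation ρ) := by
          rw [hσ.sup_eq_top]
          trivial
        obtain ⟨y, hy, z, hz, rfl⟩ := Submodule.mem_sup.mp hx
        have hy' := congrArg (fun t : Module.End ℂ τ.toSubmodule => (t ⟨y, hy⟩ : V)) h1
        have hz' := congrArg (fun t : Module.End ℂ σ.toSubmodule => (t ⟨z, hz⟩ : V)) h2
        change ρ g y = y at hy'
        change ρ g z = z at hz'
        rw [map_add, hy', hz', Module.End.one_apply]
      · refine hsub σ (fun h => hbot ?_) h2
        rw [h] at hσ
        exact eq_bot_of_isCompl_top hσ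
    · exact hsub τ htop h1

/-- An element of the derived subgroup outside a normal subgroup `N` is detected by a non-linear
irreducible representation that is trivial on `N`. -/
theorem exists_nonlinear_simple [Finite G] (N : Subgroup G) [N.Normal] {x : G}
    (hx : x ∈ commutator G) (hxN : x ∉ N) :
    ∃ W : FDRep ℂ G, Simple W ∧ 1 < Module.finrank ℂ W ∧ W.ρ x ≠ 1 ∧ ∀ n ∈ N, W.ρ n = 1 := by
  set ρ := Representation.ofMulAction ℂ G (G ⧸ N) with hρ
  have hρx : ρ x ≠ 1 := by
    intro h
    have h1 : ρ x (MonoidAlgebra.single ((1 : G) : G ⧸ N) 1) =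
        MonoidAlgebra.single ((1 : G) : G ⧸ N) 1 := by rw [h, Module.End.one_apply]
    rw [hρ, Representation.ofMulAction_single] at h1
    have h2 := MonoidAlgebra.single_left_injective one_ne_zero h1
    rw [MulAction.Quotient.smul_coe, smul_eq_mul, mul_one] at h2
    exact hxN ((QuotientGroup.eq_one_iff x).mp h2)
  obtain ⟨W, hW, hWx, hWN⟩ := exists_simple_of_ne_one _ hρx
  refine ⟨W, hW, ?_, hWx, fun n hn => hWN n ?_⟩
  · by_contra! hle
    exact hWx (W.commutator_le_ker_of_finrank_le_one hle hx)
  · refine LinearMap.ext fun f => ?_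
    ext q
    rw [hρ, Representation.coeff_ofMulAction, Module.End.one_apply]
    obtain ⟨g, rfl⟩ := QuotientGroup.mk_surjective q
    rw [MulAction.Quotient.smul_coe, smul_eq_mul, QuotientGroup.mk_mul,
      (QuotientGroup.eq_one_iff n⁻¹).mpr (inv_mem hn), one_mul]

/-- If the kernel of `V` is maximal among kernels of non-linear irreducible representations of a
`p`-group, then modulo that kernel the derived subgroup lies in a central subgroup of order `p`. -/
theorem exists_central_zpowers_of_maximal {p : ℕ} (hp : p.Prime) [Finite G] (hpG : IsPGroup p G)
    (V : FDRep ℂ G) [Simple V] (hV : 1 < Module.finrank ℂ V)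
    (hmax : ∀ W : FDRep ℂ G, Simple W → 1 < Module.finrank ℂ W →
      V.ρ.ker ≤ W.ρ.ker → W.ρ.ker ≤ V.ρ.ker) :
    ∃ z : G ⧸ V.ρ.ker, z ∈ Subgroup.center (G ⧸ V.ρ.ker) ∧ z ^ p = 1 ∧
      ∀ c ∈ commutator G, (c : G ⧸ V.ρ.ker) ∈ Subgroup.zpowers z := by
  have := Fact.mk hp
  have hQ : IsPGroup p (G ⧸ V.ρ.ker) := hpG.to_quotient _
  have hnt : Nontrivial (G ⧸ V.ρ.ker) := by
    rw [QuotientGroup.nontrivial_iff]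
    intro h
    exact V.not_commutator_le_ker hV (h ▸ le_top)
  have hdvd : p ∣ Nat.card (Subgroup.center (G ⧸ V.ρ.ker)) := by
    have := hQ.center_nontrivial
    obtain ⟨n, hn, h⟩ := (hQ.to_subgroup (Subgroup.center _)).nontrivial_iff_card.mp this
    rw [h]
    exact dvd_pow_self p hn.ne'
  obtain ⟨⟨z, hz⟩, hzo⟩ := exists_prime_orderOf_dvd_card' p hdvd
  rw [Subgroup.orderOf_mk] at hzo
  refine ⟨z, hz, hzo ▸ pow_orderOf_eq_one z, fun c hc => ?_⟩
  have hle : Subgroup.zpowers z ≤ Subgroup.center _ := by simpa using hz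
  have hnormal : (Subgroup.zpowers z).Normal := ⟨fun n hn g => by
    rwa [Subgroup.mem_center_iff.mp (hle hn) g, mul_inv_cancel_right]⟩
  by_contra hcz
  obtain ⟨W, hW, hW1, -, hWN⟩ := exists_nonlinear_simple
    ((Subgroup.zpowers z).comap (QuotientGroup.mk' V.ρ.ker)) hc hcz
  obtain ⟨g, rfl⟩ := QuotientGroup.mk_surjective z
  have hVW : V.ρ.ker ≤ W.ρ.ker := fun k hk => hWN k (by
    rw [Subgroup.mem_comap, QuotientGroup.mk'_apply, (QuotientGroup.eq_one_iff k).mpr hk]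
    exact one_mem _)
  have hg : g ∈ V.ρ.ker := hmax W hW hW1 hVW (hWN g (Subgroup.mem_zpowers _))
  rw [(QuotientGroup.eq_one_iff g).mpr hg, orderOf_one] at hzo
  exact hp.one_lt.ne hzo

/-- If some `x` in the kernel of `W` acts on `V` as a nontrivial scalar, then `ker V ≤ ker W`
forces every central element of order dividing `p` into the kernel of `W`. -/
theorem mem_ker_of_scalar {p : ℕ} (hp : p.Prime) (hpG : IsPGroup p G)
    (V W : FDRep ℂ G) [Simple V] (hVW : V.ρ.ker ≤ W.ρ.ker) {x : G} (hxW : x ∈ W.ρ.ker)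
    (hxV : x ∉ V.ρ.ker) (hcomm : ∀ g, Commute (V.ρ x) (V.ρ g)) {c : G}
    (hc : c ∈ Subgroup.center G) (hcp : c ^ p = 1) : c ∈ W.ρ.ker := by
  have hne : (1 : Module.End ℂ V) ≠ 0 := fun h => hxV (by
    rw [MonoidHom.mem_ker, ← mul_one (V.ρ x), h, mul_zero])
  have hinj : Function.Injective fun r : ℂ => r • (1 : Module.End ℂ V) :=
    smul_left_injective ℂ hne
  obtain ⟨a, ha⟩ := V.exists_eq_smul_one_of_commute (V.ρ x) hcomm
  obtain ⟨b, hb⟩ := V.exists_eq_smul_one_of_commute (V.ρ c) fun g => by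
    change V.ρ c * V.ρ g = V.ρ g * V.ρ c
    rw [← map_mul, ← map_mul, Subgroup.mem_center_iff.mp hc g]
  have ha1 : a ≠ 1 := fun h => hxV (by rw [MonoidHom.mem_ker, ha, h, one_smul])
  have hbp : b ^ p = 1 := hinj (by
    change b ^ p • (1 : Module.End ℂ V) = (1 : ℂ) • 1
    rw [← one_pow (M := Module.End ℂ V) p, ← smul_pow, ← hb, ← map_pow, hcp, map_one, one_smul,
      one_pow])
  obtain ⟨k, hk⟩ := hpG x
  have hak : a ^ p ^ k = 1 := hinj (by
    change a ^ p ^ k • (1 : Module.End ℂ V) = (1 : ℂ) • 1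
    rw [← one_pow (M := Module.End ℂ V) (p ^ k), ← smul_pow, ← ha, ← map_pow, hk, map_one,
      one_smul, one_pow])
  obtain ⟨j, -, hj⟩ := (Nat.dvd_prime_pow hp).mp (orderOf_dvd_of_pow_eq_one hak)
  obtain _ | j := j
  · exact absurd (orderOf_eq_one_iff.mp (by simpa using hj)) ha1
  have hprim : IsPrimitiveRoot (a ^ p ^ j) p :=
    (IsPrimitiveRoot.orderOf a).pow (orderOf_pos_iff.mpr
      (isOfFinOrder_iff_pow_eq_one.mpr ⟨_, pow_pos hp.pos k, hak⟩)) (by rw [hj, pow_succ])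
  have : NeZero p := ⟨hp.ne_zero⟩
  obtain ⟨i, -, hi⟩ := hprim.eq_pow_of_pow_eq_one hbp
  have hxc : V.ρ ((x ^ p ^ j) ^ i) = V.ρ c := by
    rw [map_pow, map_pow, ha, hb, smul_pow, smul_pow, one_pow, one_pow, hi]
  have hmem : c * ((x ^ p ^ j) ^ i)⁻¹ ∈ V.ρ.ker := by
    rw [MonoidHom.mem_ker, map_mul, ← hxc, ← map_mul, mul_inv_cancel, map_one]
  rw [← inv_mul_cancel_right c ((x ^ p ^ j) ^ i)]
  exact mul_mem (hVW hmem) (pow_mem (pow_mem hxW _) _)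

/-- In a `p`-group whose derived subgroup is central of exponent dividing `p`, nested kernels of
non-linear irreducible representations coincide. -/
theorem ker_le_of_ker_le {p : ℕ} (hp : p.Prime) (hpG : IsPGroup p G)
    (hcenter : commutator G ≤ Subgroup.center G) (hexp : ∀ c ∈ commutator G, c ^ p = 1)
    (V W : FDRep ℂ G) [Simple V] [Simple W] (hW : 1 < Module.finrank ℂ W)
    (hVW : V.ρ.ker ≤ W.ρ.ker) : W.ρ.ker ≤ V.ρ.ker := by
  by_contra hle
  obtain ⟨x, hxW, hxV⟩ := SetLike.not_le_iff_exists.mp hle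
  suffices ∃ y ∈ W.ρ.ker, y ∉ V.ρ.ker ∧ ∀ g, Commute (V.ρ y) (V.ρ g) by
    obtain ⟨y, hyW, hyV, hcomm⟩ := this
    exact W.not_commutator_le_ker hW fun c hc =>
      mem_ker_of_scalar hp hpG V W hVW hyW hyV hcomm (hcenter hc) (hexp c hc)
  by_cases hcomm : ∀ g, Commute (V.ρ x) (V.ρ g)
  · exact ⟨x, hxW, hxV, hcomm⟩
  push Not at hcomm
  obtain ⟨g, hg⟩ := hcomm
  have hmem : ⁅x, g⁆ ∈ commutator G := Subgroup.commutator_mem_commutator trivial trivial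
  refine ⟨⁅x, g⁆, ?_, fun h => hg ?_, fun k => ?_⟩
  · rw [commutatorElement_def, mul_assoc, mul_assoc]
    refine mul_mem hxW ?_
    rw [← mul_assoc]
    exact (inferInstance : W.ρ.ker.Normal).conj_mem _ (inv_mem hxW) g
  · have h2 : ⁅x, g⁆ * (g * x) = x * g := by group
    change V.ρ x * V.ρ g = V.ρ g * V.ρ x
    rw [← map_mul, ← map_mul, ← h2, map_mul, h, one_mul]
  · change V.ρ _ * V.ρ k = V.ρ k * V.ρ _
    rw [← map_mul, ← map_mul, Subgroup.mem_center_iff.mp (hcenter hmem) k]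

end FDRep

/-- For a non-Abelian finite `p`-group `G` (`p` odd), any two distinct kernels of
non-linear irreducible complex characters of `G` are nonincident (neither contains the
other) iff `G' ⊆ Z(G)` and `exp G' = p`. -/
theorem kernels_nonincident_iff (p : ℕ) (hp : p.Prime) (hodd : Odd p)
    (G : Type) [Group G] [Fintype G] (hpG : IsPGroup p G)
    (hnab : ¬ ∀ a b : G, a * b = b * a) :
    (∀ V W : FDRep ℂ G, Simple V → 1 < Module.finrank ℂ V →
        Simple W → 1 < Module.finrank ℂ W → charKer V ≠ charKer W →
        ¬ charKer V ⊆ charKer W ∧ ¬ charKer W ⊆ charKer V) ↔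
      (commutator G ≤ Subgroup.center G ∧
        Monoid.exponent ↥(commutator G) = p) := by
  have hker : ∀ V W : FDRep ℂ G, charKer V ⊆ charKer W ↔ V.ρ.ker ≤ W.ρ.ker := fun V W => by
    simp only [Set.subset_def, FDRep.mem_charKer_iff, SetLike.le_def, MonoidHom.mem_ker]
  constructor
  · intro H
    have hmax : ∀ V W : FDRep ℂ G, Simple V → 1 < Module.finrank ℂ V → Simple W →
        1 < Module.finrank ℂ W → V.ρ.ker ≤ W.ρ.ker → W.ρ.ker ≤ V.ρ.ker := by
      intro V W hV hV1 hW hW1 hle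
      by_contra hnle
      have hne : charKer V ≠ charKer W := fun h => hnle ((hker W V).mp h.ge)
      exact (H V W hV hV1 hW hW1 hne).1 ((hker V W).mpr hle)
    have htriv : ∀ x ∈ commutator G, (∀ V : FDRep ℂ G, Simple V → 1 < Module.finrank ℂ V →
        x ∈ V.ρ.ker) → x = 1 := by
      intro x hx h
      by_contra hx1
      obtain ⟨W, hW, hW1, hWx, -⟩ := FDRep.exists_nonlinear_simple ⊥ hx
        (by rwa [Subgroup.mem_bot])
      exact hWx (h W hW hW1)
    have hcenter : commutator G ≤ Subgroup.center G := by
      intro c hc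
      rw [Subgroup.mem_center_iff]
      intro g
      rw [← commutatorElement_eq_one_iff_mul_comm]
      refine htriv _ (Subgroup.commutator_mem_commutator trivial trivial) fun V hV hV1 => ?_
      obtain ⟨z, hz, -, hcz⟩ := V.exists_central_zpowers_of_maximal hp hpG hV1
        fun W hW hW1 => hmax V W hV hV1 hW hW1
      have hc' : (c : G ⧸ V.ρ.ker) ∈ Subgroup.center _ :=
        (Subgroup.zpowers_le.mpr hz) (hcz c hc)
      rw [← QuotientGroup.eq_one_iff]
      change ⁅(g : G ⧸ V.ρ.ker), (c : G ⧸ V.ρ.ker)⁆ = 1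
      rw [commutatorElement_eq_one_iff_mul_comm]
      exact Subgroup.mem_center_iff.mp hc' g
    have hexp : ∀ c ∈ commutator G, c ^ p = 1 := by
      intro c hc
      refine htriv _ (pow_mem hc p) fun V hV hV1 => ?_
      obtain ⟨z, -, hzp, hcz⟩ := V.exists_central_zpowers_of_maximal hp hpG hV1
        fun W hW hW1 => hmax V W hV hV1 hW hW1
      obtain ⟨i, hi⟩ := Subgroup.mem_zpowers_iff.mp (hcz c hc)
      rw [← QuotientGroup.eq_one_iff, QuotientGroup.mk_pow, ← hi, ← zpow_natCast, zpow_comm,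
        zpow_natCast, hzp, one_zpow]
    refine ⟨hcenter, ?_⟩
    have hdvd : Monoid.exponent (commutator G) ∣ p :=
      Monoid.exponent_dvd_of_forall_pow_eq_one fun c => Subtype.ext (hexp c c.2)
    refine (hp.eq_one_or_self_of_dvd _ hdvd).resolve_left fun h1 => hnab fun a b => ?_
    have hsub : Subsingleton (commutator G) := Monoid.exp_eq_one_iff.mp h1
    rw [← commutatorElement_eq_one_iff_mul_comm]
    exact congrArg Subtype.val (hsub.elim
      (⟨⁅a, b⁆, Subgroup.commutator_mem_commutator trivial trivial⟩ : commutator G) 1)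
  · rintro ⟨hcenter, hexp⟩ V W hV hV1 hW hW1 hne
    have hpow : ∀ c ∈ commutator G, c ^ p = 1 := fun c hc => by
      have h := Monoid.pow_exponent_eq_one (⟨c, hc⟩ : commutator G)
      rw [hexp] at h
      exact congrArg Subtype.val h
    refine ⟨fun h => hne (h.antisymm ?_), fun h => hne (Set.Subset.antisymm ?_ h)⟩
    · exact (hker W V).mpr
        (FDRep.ker_le_of_ker_le hp hpG hcenter hpow V W hW1 ((hker V W).mp h))
    · exact (hker V W).mpr
        (FDRep.ker_le_of_ker_le hp hpG hcenter hpow W V hV1 ((hker W V).mp h))
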